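/- Let F: X → Y and H: Y → Z be functors and set G = H ∘ F. Call a functor q: A → B a cocartesian fibration if every morphism β: q(a) → b of B admits a q-cocartesian lift a → ā. Assume: (a) G and H are cocartesian fibrations; (b) F sends G-cocartesian morphisms to H-cocartesian morphisms; (c) for every object a of Z, the induced functor F_a: X_a → Y_a between the fiber categories over a is a cocartesian fibration; (d) for every morphism α: a → b of Z and every F_a-cocartesian morphism ψ: m → m' in X_a, if φ: m → n and φ': m' → n' are G-cocartesian lifts of α and ψ': n → n' is the unique morphism lying over the identity of b with ψ' ∘ φ = φ' ∘ ψ, then ψ' is F_b-cocartesian. Then F is a cocartesian fibration. -/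

import Mathlib

open CategoryTheory

universe u v u₁ u₂ v₁ v₂

namespace EnrichedCat

/-- The category of finite pointed sets `E₊`, modeled as finite types with
partially defined maps (`f e = none` meaning `e` is sent to the basepoint). -/
structure FinPtd : Type 1 where
  carrier : Type
  [fintype : Fintype carrier]

attribute [instance] FinPtd.fintype

instance : Category FinPtd where
  Hom E T := E.carrier → Option T.carrier
  id E := fun e => some e
  comp f g := fun e => (f e).bind g
  id_comp f := rfl
  comp_id f := by
    funext e
    show (f e).bind (fun x => some x) = f e
    cases f e <;> rfl
  assoc f g h := by
    funext e
    show ((f e).bind g).bind h = (f e).bind (fun x => (g x).bind h)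
    cases f e <;> rfl

/-- A morphism of pointed sets is inert if every non-basepoint element of the
target has exactly one preimage. -/
def FinPtd.IsInert {E T : FinPtd} (f : E ⟶ T) : Prop :=
  ∀ t : T.carrier, ∃! e : E.carrier, f e = some t

/-- A morphism of pointed sets is active if only the basepoint hits the basepoint. -/
def FinPtd.IsActive {E T : FinPtd} (f : E ⟶ T) : Prop :=
  ∀ e : E.carrier, f e ≠ none

/-- `φ` is `p`-cocartesian: any `h` out of its source factoring over `p φ`
factors uniquely through `φ`. -/
def IsCocartesian {C : Type u₁} {D : Type u₂} [Category.{v₁} C] [Category.{v₂} D]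
    (p : C ⥤ D) {c c' : C} (φ : c ⟶ c') : Prop :=
  ∀ {c'' : C} (h : c ⟶ c'') (u : p.obj c' ⟶ p.obj c''),
    p.map h = p.map φ ≫ u → ∃! u' : c' ⟶ c'', p.map u' = u ∧ φ ≫ u' = h

/-- `ψ` is `p`-cartesian. -/
def IsCartesian {C : Type u₁} {D : Type u₂} [Category.{v₁} C] [Category.{v₂} D]
    (p : C ⥤ D) {c' c : C} (ψ : c' ⟶ c) : Prop :=
  ∀ {c'' : C} (g : c'' ⟶ c) (v : p.obj c'' ⟶ p.obj c'),
    p.map g = v ≫ p.map ψ → ∃! v' : c'' ⟶ c', p.map v' = v ∧ v' ≫ ψ = g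

/-- The (strict) fiber of a functor over an object: objects mapping to `d`
and morphisms mapping to the identity of `d`. -/
def Fiber {C : Type u₁} {D : Type u₂} [Category.{v₁} C] [Category.{v₂} D]
    (p : C ⥤ D) (d : D) : Type u₁ :=
  {c : C // p.obj c = d}

instance {C : Type u₁} {D : Type u₂} [Category.{v₁} C] [Category.{v₂} D]
    (p : C ⥤ D) (d : D) : Category (Fiber p d) where
  Hom X Y := {f : X.1 ⟶ Y.1 // p.map f = eqToHom (X.2.trans Y.2.symm)}
  id X := ⟨𝟙 X.1, by rw [p.map_id]; exact (eqToHom_refl _ _).symm⟩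
  comp f g := ⟨f.1 ≫ g.1, by rw [p.map_comp, f.2, g.2, eqToHom_trans]⟩
  id_comp f := Subtype.ext (Category.id_comp f.1)
  comp_id f := Subtype.ext (Category.comp_id f.1)
  assoc f g h := Subtype.ext (Category.assoc f.1 g.1 h.1)

end EnrichedCat

namespace EnrichedCat

/-- A functor is a cocartesian fibration if every morphism out of the image of
an object admits a cocartesian lift. -/
def IsCocartesianFibration {C : Type u₁} {D : Type u₂}
    [Category.{v₁} C] [Category.{v₂} D] (p : C ⥤ D) : Prop :=
  ∀ (a : C) (b : D) (β : p.obj a ⟶ b),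
    ∃ (abar : C) (φ : a ⟶ abar) (h : p.obj abar = b),
      IsCocartesian p φ ∧ p.map φ ≫ eqToHom h = β

/-- The functor induced on fibers over `a : Z` by `F : X ⥤ Y` over `Z`
(with `G = F ⋙ H` the composite projection). -/
def fiberFunctor {X : Type u₁} {Y : Type u₂} {Z : Type u}
    [Category.{v₁} X] [Category.{v₂} Y] [Category.{v} Z]
    (F : X ⥤ Y) (H : Y ⥤ Z) (a : Z) : Fiber (F ⋙ H) a ⥤ Fiber H a where
  obj x := ⟨F.obj x.1, x.2⟩
  map {x x'} f := ⟨F.map f.1, f.2⟩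
  map_id x := Subtype.ext (F.map_id x.1)
  map_comp f g := Subtype.ext (F.map_comp f.1 g.1)

/-- The underlying morphism of a morphism in a fiber. -/
def fiberHomVal {C : Type u₁} {D : Type u₂} [Category.{v₁} C] [Category.{v₂} D]
    {p : C ⥤ D} {d : D} {X Y : Fiber p d} (f : X ⟶ Y) : X.1 ⟶ Y.1 :=
  Subtype.val f

section Cocartesian

variable {C : Type u₁} {D : Type u₂} [Category.{v₁} C] [Category.{v₂} D] {p : C ⥤ D}

theorem IsCocartesian.hom_ext {c c' c'' : C} {φ : c ⟶ c'} (hφ : IsCocartesian p φ)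
    {f g : c' ⟶ c''} (hp : p.map f = p.map g) (h : φ ≫ f = φ ≫ g) : f = g :=
  (hφ (φ ≫ g) (p.map g) (p.map_comp φ g)).unique ⟨hp, h⟩ ⟨rfl, rfl⟩

theorem IsCocartesian.comp {c c' c'' : C} {φ : c ⟶ c'} {ψ : c' ⟶ c''}
    (hφ : IsCocartesian p φ) (hψ : IsCocartesian p ψ) : IsCocartesian p (φ ≫ ψ) := by
  intro x h u hu
  obtain ⟨k, ⟨hk, hφk⟩, -⟩ := hφ h (p.map ψ ≫ u) (by simpa using hu)
  obtain ⟨l, ⟨hl, hψl⟩, -⟩ := hψ k u hk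
  refine ⟨l, ⟨hl, by rw [Category.assoc, hψl, hφk]⟩, ?_⟩
  rintro l' ⟨hl', hl''⟩
  refine hψ.hom_ext (hl'.trans hl.symm) (hφ.hom_ext ?_ ?_)
  · simp only [Functor.map_comp, hl', hl]
  · rw [hψl, hφk, ← hl'', Category.assoc]

end Cocartesian

section Composite

variable {X : Type u₁} {Y : Type u₂} {Z : Type u}
  [Category.{v₁} X] [Category.{v₂} Y] [Category.{v} Z] {F : X ⥤ Y} {H : Y ⥤ Z}

/-- A morphism that is cocartesian for `F ⋙ H` and whose image under `F` is `H`-cocartesian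
is `F`-cocartesian. -/
theorem IsCocartesian.of_comp {c c' : X} {φ : c ⟶ c'} (hφ : IsCocartesian (F ⋙ H) φ)
    (hFφ : IsCocartesian H (F.map φ)) : IsCocartesian F φ := by
  intro x h u hu
  obtain ⟨k, ⟨hk, hφk⟩, -⟩ := hφ h (H.map u) (by simp [hu])
  refine ⟨k, ⟨hFφ.hom_ext hk ?_, hφk⟩, ?_⟩
  · rw [← F.map_comp, hφk, hu]
  · rintro k' ⟨hk', hφk'⟩
    refine hφ.hom_ext ?_ (hφk'.trans hφk.symm)
    rw [hk, Functor.comp_map, hk']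

/-- A morphism of a fiber that is cocartesian for the functor induced by `F` on that fiber is
`F`-cocartesian, provided cocartesian transport preserves fiberwise cocartesian morphisms. -/
theorem IsCocartesian.of_fiberFunctor
    (hG : IsCocartesianFibration (F ⋙ H))
    (hFcoc : ∀ {x x' : X} (φ : x ⟶ x'),
      IsCocartesian (F ⋙ H) φ → IsCocartesian H (F.map φ))
    {a : Z} {m m' : Fiber (F ⋙ H) a} {ψ : m ⟶ m'}
    (htrans : ∀ (b : Z) (α : a ⟶ b) (n n' : Fiber (F ⋙ H) b) (φ : m.1 ⟶ n.1) (φ' : m'.1 ⟶ n'.1),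
        IsCocartesian (F ⋙ H) φ → IsCocartesian (F ⋙ H) φ' →
        (F ⋙ H).map φ = eqToHom m.2 ≫ α ≫ eqToHom n.2.symm →
        (F ⋙ H).map φ' = eqToHom m'.2 ≫ α ≫ eqToHom n'.2.symm →
        ∀ ψ' : n ⟶ n', fiberHomVal ψ ≫ φ' = φ ≫ fiberHomVal ψ' →
          IsCocartesian (fiberFunctor F H b) ψ') :
    IsCocartesian F (fiberHomVal ψ) := by
  obtain ⟨m, hm⟩ := m
  obtain ⟨m', rfl⟩ := m'
  obtain ⟨ψ, hψ⟩ := ψ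
  dsimp only [fiberHomVal] at *
  intro x h u hu
  obtain ⟨n, φ, hn, hφ, hφα⟩ := hG m (H.obj (F.obj x)) (eqToHom hm ≫ H.map u)
  obtain ⟨n', φ', hn', hφ', hφα'⟩ := hG m' (H.obj (F.obj x)) (H.map u)
  have eφ : (F ⋙ H).map φ = eqToHom hm ≫ H.map u ≫ eqToHom hn.symm := by
    rw [← Category.assoc, ← hφα]; simp
  have eφ' : (F ⋙ H).map φ' = H.map u ≫ eqToHom hn'.symm := by
    rw [← hφα']; simp
  obtain ⟨ψ', ⟨hψ', sq⟩, -⟩ := hφ (ψ ≫ φ') (eqToHom (hn.trans hn'.symm)) (by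
    rw [Functor.map_comp, eφ, eφ', hψ]; simp)
  have hcoc : IsCocartesian (fiberFunctor F H (H.obj (F.obj x)))
      (c := ⟨n, hn⟩) (c' := ⟨n', hn'⟩) ⟨ψ', hψ'⟩ := htrans _ (H.map u) ⟨n, hn⟩ ⟨n', hn'⟩ φ φ' hφ hφ' eφ
    (by rw [eφ']; simp) ⟨ψ', hψ'⟩ sq.symm
  obtain ⟨h', ⟨hh', fac⟩, -⟩ := hφ h (eqToHom hn) (by
    rw [hφα, Functor.comp_map, hu, H.map_comp]
    exact congrArg (· ≫ H.map u) hψ)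
  obtain ⟨u', ⟨hu', facu⟩, -⟩ := hFcoc φ' hφ' u (eqToHom hn') hφα'.symm
  have compat : F.map h' = F.map ψ' ≫ u' := by
    refine IsCocartesian.hom_ext (hFcoc φ hφ) ?_ ?_
    · rw [H.map_comp, hu']
      refine hh'.trans ?_
      rw [← Functor.comp_map, hψ']
      exact (eqToHom_trans _ _).symm
    · rw [← F.map_comp, fac, hu, ← Category.assoc, ← F.map_comp, sq, F.map_comp, Category.assoc,
        facu]
  obtain ⟨k, ⟨hk, hψk⟩, huniq⟩ := hcoc (c'' := ⟨x, rfl⟩) ⟨h', hh'⟩ ⟨u', hu'⟩ (Subtype.ext compat)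
  have hk₁ : F.map k.1 = u' := congrArg Subtype.val hk
  have hψk₁ : ψ' ≫ k.1 = h' := congrArg Subtype.val hψk
  refine ⟨φ' ≫ k.1, ⟨?_, ?_⟩, ?_⟩
  · rw [F.map_comp, hk₁, facu]
  · rw [← Category.assoc, ← sq, Category.assoc, hψk₁, fac]
  · rintro w ⟨hw, hψw⟩
    obtain ⟨w', ⟨hw', facw⟩, -⟩ := hφ' w (eqToHom hn') (by
      rw [hφα', Functor.comp_map, hw])
    have hFw : F.map w' = u' := by
      refine IsCocartesian.hom_ext (hFcoc φ' hφ') (hw'.trans hu'.symm) ?_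
      rw [← F.map_comp, facw, hw, facu]
    have hψw' : ψ' ≫ w' = h' := by
      refine hφ.hom_ext ?_ ?_
      · rw [Functor.map_comp, hψ', hw', hh']
        exact eqToHom_trans _ _
      · rw [← Category.assoc, sq, Category.assoc, facw, hψw, fac]
    have hwk := huniq ⟨w', hw'⟩ ⟨Subtype.ext hFw, Subtype.ext hψw'⟩
    rw [← facw, ← hwk]

end Composite

/-- **Statement 19.** Let `F : X ⥤ Y`, `H : Y ⥤ Z` and `G = H ∘ F`.  Suppose:
(a) `G` and `H` are cocartesian fibrations; (b) `F` sends `G`-cocartesian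
morphisms to `H`-cocartesian morphisms; (c) each induced functor on fibers
`F_a : X_a ⥤ Y_a` is a cocartesian fibration; (d) for each `α : a ⟶ b` in `Z`,
the transition functors carry `F_a`-cocartesian morphisms to `F_b`-cocartesian
morphisms (formulated via `G`-cocartesian lifts).  Then `F` is a cocartesian
fibration. -/
theorem cocartesian_fibration_of_fiberwise {X : Type u₁} {Y : Type u₂} {Z : Type u}
    [Category.{v₁} X] [Category.{v₂} Y] [Category.{v} Z]
    (F : X ⥤ Y) (H : Y ⥤ Z)
    (hG : IsCocartesianFibration (F ⋙ H))
    (hH : IsCocartesianFibration H)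
    (hFcoc : ∀ {x x' : X} (φ : x ⟶ x'),
      IsCocartesian (F ⋙ H) φ → IsCocartesian H (F.map φ))
    (hfib : ∀ a : Z, IsCocartesianFibration (fiberFunctor F H a))
    (htrans : ∀ (a b : Z) (α : a ⟶ b) (m m' : Fiber (F ⋙ H) a) (ψ : m ⟶ m'),
      IsCocartesian (fiberFunctor F H a) ψ →
      ∀ (n n' : Fiber (F ⋙ H) b) (φ : m.1 ⟶ n.1) (φ' : m'.1 ⟶ n'.1),
        IsCocartesian (F ⋙ H) φ → IsCocartesian (F ⋙ H) φ' →
        (F ⋙ H).map φ = eqToHom m.2 ≫ α ≫ eqToHom n.2.symm →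
        (F ⋙ H).map φ' = eqToHom m'.2 ≫ α ≫ eqToHom n'.2.symm →
        ∀ ψ' : n ⟶ n', fiberHomVal ψ ≫ φ' = φ ≫ fiberHomVal ψ' →
          IsCocartesian (fiberFunctor F H b) ψ') :
    IsCocartesianFibration F := by
  intro a y β
  obtain ⟨n, φ, hn, hφ, hφα⟩ := hG a (H.obj y) (H.map β)
  obtain ⟨β', ⟨hβ', fac⟩, -⟩ := hFcoc φ hφ β (eqToHom hn) hφα.symm
  obtain ⟨⟨n', hn'⟩, ψ, hy, hψ, hψβ⟩ :=
    hfib (H.obj y) ⟨n, hn⟩ ⟨y, rfl⟩ ⟨β', hβ'⟩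
  have hψF : IsCocartesian F (fiberHomVal ψ) := IsCocartesian.of_fiberFunctor hG hFcoc
    (fun b α => htrans _ b α _ _ ψ hψ)
  have hy' : F.obj n' = y := congrArg Subtype.val hy
  refine ⟨n', φ ≫ fiberHomVal ψ, hy', IsCocartesian.comp (hφ.of_comp (hFcoc φ hφ)) hψF, ?_⟩
  subst hy'
  have hψβ' : F.map (fiberHomVal ψ) ≫ 𝟙 _ = β' := congrArg Subtype.val hψβ
  simpa [← hψβ'] using fac

end EnrichedCat
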